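/- arXiv:1106.1768 — 2 statements merged into one kernel-verified Lean document; each statement's English description precedes it below -/
import Mathlib

section
/- Let 0 < a < 1 < b, define φ(y) = max{y^a, y^b} and φ⁻¹(y) = min{y^{1/a}, y^{1/b}} for y > 0, and let c, d > 0 with c·d ≤ 1. Define g(x) = x·F(c,d;c+d;x) for x ∈ (0,1). Then for every x ∈ (0,1), g(x) ≤ b · φ( g( φ⁻¹(x/(1-x)) / (1 + φ⁻¹(x/(1-x))) ) ). -/
/-- The Gaussian hypergeometric function `₂F₁(a,b;c;x)` defined by its Maclaurin
series `∑ (a)ₙ(b)ₙ/((c)ₙ n!) xⁿ`, where `(a)ₙ` is the rising factorial. -/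
noncomputable def hypergeom (a b c x : ℝ) : ℝ :=
  ∑' n : ℕ, ((∏ k ∈ Finset.range n, (a + k)) * (∏ k ∈ Finset.range n, (b + k)) /
      ((∏ k ∈ Finset.range n, (c + k)) * (Nat.factorial n))) * x ^ n

open Finset in
/-- If `r` is antitone and `w ≥ 0`, the quotient of the power series with coefficients `r n * w n`
and `w n` is antitone on `[0, 1)`, in cross-multiplied form. -/
theorem tsum_mul_tsum_le_of_antitone {r w : ℕ → ℝ} (hr : Antitone r) (hw : ∀ n, 0 ≤ w n)
    {x y : ℝ} (hx : 0 ≤ x) (hxy : x ≤ y)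
    (hwx : Summable fun n => w n * x ^ n) (hwy : Summable fun n => w n * y ^ n)
    (hrx : Summable fun n => r n * w n * x ^ n) (hry : Summable fun n => r n * w n * y ^ n) :
    (∑' n, r n * w n * y ^ n) * (∑' n, w n * x ^ n) ≤
      (∑' n, r n * w n * x ^ n) * (∑' n, w n * y ^ n) := by
  have hlim : ∀ {p q : ℕ → ℝ}, Summable p → Summable q →
      Filter.Tendsto (fun N => (∑ n ∈ range N, p n) * ∑ n ∈ range N, q n) Filter.atTop
        (nhds ((∑' n, p n) * ∑' n, q n)) := fun hp hq =>
    hp.hasSum.tendsto_sum_nat.mul hq.hasSum.tendsto_sum_nat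
  refine le_of_tendsto_of_tendsto' (hlim hry hwx) (hlim hrx hwy) fun N => ?_
  have hy : 0 ≤ y := hx.trans hxy
  have key : ∀ i j : ℕ, i ≤ j →
      0 ≤ w i * w j * ((x ^ i * y ^ j - y ^ i * x ^ j) * (r i - r j)) := by
    intro i j hij
    obtain ⟨k, rfl⟩ := Nat.exists_eq_add_of_le hij
    have h1 : x ^ i * y ^ (i + k) - y ^ i * x ^ (i + k) = (x * y) ^ i * (y ^ k - x ^ k) := by
      ring
    have h2 : x ^ k ≤ y ^ k := pow_le_pow_left₀ hx hxy k
    rw [h1]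
    exact mul_nonneg (mul_nonneg (hw _) (hw _)) (mul_nonneg
      (mul_nonneg (pow_nonneg (mul_nonneg hx hy) i) (sub_nonneg.2 h2)) (sub_nonneg.2 (hr hij)))
  have hsum : 0 ≤ ∑ i ∈ range N, ∑ j ∈ range N,
      w i * w j * ((x ^ i * y ^ j - y ^ i * x ^ j) * (r i - r j)) := by
    refine sum_nonneg fun i _ => sum_nonneg fun j _ => ?_
    rcases le_total i j with h | h
    · exact key i j h
    · have := key j i h
      linarith
  have hsplit : ∑ i ∈ range N, ∑ j ∈ range N,
      w i * w j * ((x ^ i * y ^ j - y ^ i * x ^ j) * (r i - r j)) =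
      2 * ((∑ n ∈ range N, r n * w n * x ^ n) * (∑ n ∈ range N, w n * y ^ n) -
        (∑ n ∈ range N, r n * w n * y ^ n) * ∑ n ∈ range N, w n * x ^ n) := by
    have e : ∀ i j, w i * w j * ((x ^ i * y ^ j - y ^ i * x ^ j) * (r i - r j)) =
        (r i * w i * x ^ i * (w j * y ^ j) - r i * w i * y ^ i * (w j * x ^ j)) +
        (w i * y ^ i * (r j * w j * x ^ j) - w i * x ^ i * (r j * w j * y ^ j)) := by
      intro i j
      ring
    simp_rw [e, sum_add_distrib, sum_sub_distrib, ← sum_mul_sum]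
    ring
  linarith

/-- The `n`-th Maclaurin coefficient of the zero-balanced hypergeometric function
`F(c, d; c + d; ·)`. -/
noncomputable def zeroBalancedCoeff (c d : ℝ) (n : ℕ) : ℝ :=
  (∏ k ∈ Finset.range n, (c + k)) * (∏ k ∈ Finset.range n, (d + k)) /
    ((∏ k ∈ Finset.range n, (c + d + k)) * (Nat.factorial n))

theorem zeroBalancedCoeff_zero (c d : ℝ) : zeroBalancedCoeff c d 0 = 1 := by
  simp [zeroBalancedCoeff]

theorem hypergeom_eq_tsum_zeroBalancedCoeff (c d x : ℝ) :
    hypergeom c d (c + d) x = ∑' n, zeroBalancedCoeff c d n * x ^ n := rfl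

section ZeroBalanced

variable {c d : ℝ}

theorem zeroBalancedCoeff_pos (hc : 0 < c) (hd : 0 < d) (n : ℕ) :
    0 < zeroBalancedCoeff c d n := by
  unfold zeroBalancedCoeff
  have h : ∀ e : ℝ, 0 < e → 0 < ∏ k ∈ Finset.range n, (e + k) := fun e he =>
    Finset.prod_pos fun k _ => by positivity
  have := h c hc
  have := h d hd
  have := h (c + d) (add_pos hc hd)
  positivity

theorem zeroBalancedCoeff_succ (hc : 0 < c) (hd : 0 < d) (n : ℕ) :
    zeroBalancedCoeff c d (n + 1) * ((c + d + n) * (n + 1)) =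
      zeroBalancedCoeff c d n * ((c + n) * (d + n)) := by
  unfold zeroBalancedCoeff
  have h : (∏ k ∈ Finset.range n, (c + d + k)) ≠ 0 :=
    (Finset.prod_pos fun k _ => by positivity).ne'
  have h' : c + d + n ≠ 0 := by positivity
  simp only [Finset.prod_range_succ, Nat.factorial_succ]
  push_cast
  field_simp

theorem two_mul_mul_le_add (hc : 0 < c) (hd : 0 < d) (hcd : c * d ≤ 1) :
    2 * (c * d) ≤ c + d := by
  have := mul_pos hc hd
  nlinarith [sq_nonneg (c - d), add_pos hc hd]

theorem antitone_zeroBalancedCoeff_mul (hc : 0 < c) (hd : 0 < d) (hcd : c * d ≤ 1) :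
    Antitone fun n : ℕ => zeroBalancedCoeff c d n * (n + 1) := by
  refine antitone_nat_of_succ_le fun n => ?_
  have hf := zeroBalancedCoeff_pos hc hd n
  have hs := zeroBalancedCoeff_succ hc hd n
  have h2 := two_mul_mul_le_add hc hd hcd
  have hn : (0 : ℝ) ≤ n := n.cast_nonneg
  have hD : 0 < (c + d + n) * ((n : ℝ) + 1) := by positivity
  refine le_of_mul_le_mul_right ?_ hD
  have hq : (c + n) * (d + n) * ((n : ℝ) + 2) ≤ (n + 1) * ((c + d + n) * (n + 1)) := by
    nlinarith [mul_nonneg hn (sub_nonneg.2 hcd)]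
  push_cast
  calc zeroBalancedCoeff c d (n + 1) * ((n : ℝ) + 1 + 1) * ((c + d + n) * (n + 1))
      = zeroBalancedCoeff c d (n + 1) * ((c + d + n) * (n + 1)) * (n + 2) := by ring
    _ = zeroBalancedCoeff c d n * ((c + n) * (d + n) * (n + 2)) := by rw [hs]; ring
    _ ≤ zeroBalancedCoeff c d n * ((n + 1) * ((c + d + n) * (n + 1))) :=
        mul_le_mul_of_nonneg_left hq hf.le
    _ = _ := by ring

theorem antitone_zeroBalancedCoeff (hc : 0 < c) (hd : 0 < d) (hcd : c * d ≤ 1) :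
    Antitone (zeroBalancedCoeff c d) := by
  refine antitone_nat_of_succ_le fun n => ?_
  have h : zeroBalancedCoeff c d (n + 1) * ((n + 1 : ℕ) + 1) ≤
      zeroBalancedCoeff c d n * (n + 1) :=
    antitone_zeroBalancedCoeff_mul hc hd hcd n.le_succ
  push_cast at h
  have hn : (0 : ℝ) < (n : ℝ) + 1 := by positivity
  refine le_of_mul_le_mul_right ?_ hn
  linarith [zeroBalancedCoeff_pos hc hd (n + 1)]

theorem zeroBalancedCoeff_le_one (hc : 0 < c) (hd : 0 < d) (hcd : c * d ≤ 1) (n : ℕ) :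
    zeroBalancedCoeff c d n ≤ 1 :=
  zeroBalancedCoeff_zero c d ▸ antitone_zeroBalancedCoeff hc hd hcd n.zero_le

theorem summable_zeroBalancedCoeff (hc : 0 < c) (hd : 0 < d) (hcd : c * d ≤ 1)
    {x : ℝ} (hx0 : 0 ≤ x) (hx1 : x < 1) :
    Summable fun n => zeroBalancedCoeff c d n * x ^ n :=
  Summable.of_nonneg_of_le
    (fun n => mul_nonneg (zeroBalancedCoeff_pos hc hd n).le (pow_nonneg hx0 n))
    (fun n => mul_le_of_le_one_left (pow_nonneg hx0 n) (zeroBalancedCoeff_le_one hc hd hcd n))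
    (summable_geometric_of_lt_one hx0 hx1)

theorem hypergeom_zeroBalanced_pos (hc : 0 < c) (hd : 0 < d) (hcd : c * d ≤ 1)
    {x : ℝ} (hx0 : 0 ≤ x) (hx1 : x < 1) : 0 < hypergeom c d (c + d) x :=
  (summable_zeroBalancedCoeff hc hd hcd hx0 hx1).tsum_pos
    (fun n => mul_nonneg (zeroBalancedCoeff_pos hc hd n).le (pow_nonneg hx0 n)) 0
    (by simp [zeroBalancedCoeff_zero])

theorem one_sub_mul_hypergeom_le_one (hc : 0 < c) (hd : 0 < d) (hcd : c * d ≤ 1)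
    {x : ℝ} (hx0 : 0 ≤ x) (hx1 : x < 1) : (1 - x) * hypergeom c d (c + d) x ≤ 1 := by
  have h : hypergeom c d (c + d) x ≤ (1 - x)⁻¹ := by
    rw [hypergeom_eq_tsum_zeroBalancedCoeff, ← tsum_geometric_of_lt_one hx0 hx1]
    exact (summable_zeroBalancedCoeff hc hd hcd hx0 hx1).tsum_le_tsum
      (fun n => mul_le_of_le_one_left (pow_nonneg hx0 n) (zeroBalancedCoeff_le_one hc hd hcd n))
      (summable_geometric_of_lt_one hx0 hx1)
  calc (1 - x) * hypergeom c d (c + d) x ≤ (1 - x) * (1 - x)⁻¹ :=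
        mul_le_mul_of_nonneg_left h (sub_pos.2 hx1).le
    _ = 1 := mul_inv_cancel₀ (sub_pos.2 hx1).ne'

/-- `(1 - x) F(c, d; c + d; x)` is antitone on `[0, 1)`. -/
theorem one_sub_mul_hypergeom_le (hc : 0 < c) (hd : 0 < d) (hcd : c * d ≤ 1)
    {x y : ℝ} (hx : 0 ≤ x) (hxy : x ≤ y) (hy : y < 1) :
    (1 - y) * hypergeom c d (c + d) y ≤ (1 - x) * hypergeom c d (c + d) x := by
  have hx1 := hxy.trans_lt hy
  have hy0 := hx.trans hxy
  have hsx := summable_zeroBalancedCoeff hc hd hcd hx hx1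
  have hsy := summable_zeroBalancedCoeff hc hd hcd hy0 hy
  have h := tsum_mul_tsum_le_of_antitone (antitone_zeroBalancedCoeff hc hd hcd)
    (w := fun _ => 1) (fun _ => zero_le_one) hx hxy
    (by simpa using summable_geometric_of_lt_one hx hx1)
    (by simpa using summable_geometric_of_lt_one hy0 hy)
    (by simpa using hsx) (by simpa using hsy)
  simp only [mul_one, one_mul, tsum_geometric_of_lt_one hx hx1,
    tsum_geometric_of_lt_one hy0 hy, ← hypergeom_eq_tsum_zeroBalancedCoeff] at h
  rw [← div_eq_mul_inv, ← div_eq_mul_inv, div_le_div_iff₀ (sub_pos.2 hx1) (sub_pos.2 hy)] at h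
  linarith

/-- `x F(c, d; c + d; x) / log (1 / (1 - x))` is antitone on `(0, 1)`. -/
theorem mul_hypergeom_mul_log_le (hc : 0 < c) (hd : 0 < d) (hcd : c * d ≤ 1)
    {x y : ℝ} (hx : 0 < x) (hxy : x ≤ y) (hy : y < 1) :
    y * hypergeom c d (c + d) y * -Real.log (1 - x) ≤
      x * hypergeom c d (c + d) x * -Real.log (1 - y) := by
  have hx1 := hxy.trans_lt hy
  have hy0 := hx.trans_le hxy
  have hlog : ∀ z : ℝ, 0 < z → z < 1 →
      HasSum (fun n : ℕ => ((n : ℝ) + 1)⁻¹ * z ^ n) (-Real.log (1 - z) / z) := by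
    intro z hz hz1
    have h := (Real.hasSum_pow_div_log_of_abs_lt_one (abs_lt.2 ⟨by linarith, hz1⟩)).div_const z
    have e : (fun n : ℕ => z ^ (n + 1) / ((n : ℝ) + 1) / z) =
        fun n : ℕ => ((n : ℝ) + 1)⁻¹ * z ^ n := by
      funext n
      field_simp
      ring
    rwa [e] at h
  have hcoeff : ∀ n : ℕ, zeroBalancedCoeff c d n * ((n : ℝ) + 1) * ((n : ℝ) + 1)⁻¹ =
      zeroBalancedCoeff c d n := fun n => by field_simp
  have h := tsum_mul_tsum_le_of_antitone (antitone_zeroBalancedCoeff_mul hc hd hcd)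
    (w := fun n : ℕ => ((n : ℝ) + 1)⁻¹) (fun n => by positivity) hx.le hxy
    (hlog x hx hx1).summable (hlog y hy0 hy).summable
    (by simpa only [hcoeff] using summable_zeroBalancedCoeff hc hd hcd hx.le hx1)
    (by simpa only [hcoeff] using summable_zeroBalancedCoeff hc hd hcd hy0.le hy)
  simp only [hcoeff, (hlog x hx hx1).tsum_eq, (hlog y hy0 hy).tsum_eq,
    ← hypergeom_eq_tsum_zeroBalancedCoeff] at h
  rw [mul_div_assoc', mul_div_assoc', div_le_div_iff₀ hx hy0] at h
  linarith

end ZeroBalanced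

theorem le_max_rpow_rpow {a b y : ℝ} (ha : a ≤ 1) (hb : 1 ≤ b) (hy : 0 < y) :
    y ≤ max (y ^ a) (y ^ b) := by
  rcases le_total y 1 with h | h
  · exact le_max_of_le_left (by simpa using Real.rpow_le_rpow_of_exponent_ge hy h ha)
  · exact le_max_of_le_right (by simpa using Real.rpow_le_rpow_of_exponent_le h hb)

/-- Theorem 4.11: for `0 < a < 1 < b`, `φ(y) = max {y^a, y^b}` with inverse
`φ⁻¹(y) = min {y^{1/a}, y^{1/b}}`, and `c, d > 0` with `cd ≤ 1`, setting
`g(x) = x·F(c,d;c+d;x)`, one has for every `x ∈ (0,1)`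
`g(x) ≤ b·φ( g( φ⁻¹(x/(1-x)) / (1 + φ⁻¹(x/(1-x))) ) )`. -/
theorem hypergeom_generalized_bernoulli (a b c d : ℝ) (ha : 0 < a) (ha1 : a < 1)
    (hb : 1 < b) (hc : 0 < c) (hd : 0 < d) (hcd : c * d ≤ 1)
    (x : ℝ) (hx0 : 0 < x) (hx1 : x < 1) :
    x * hypergeom c d (c + d) x ≤
      b * (let u : ℝ := min ((x / (1 - x)) ^ (1 / a)) ((x / (1 - x)) ^ (1 / b));
           let gu : ℝ := u / (1 + u) * hypergeom c d (c + d) (u / (1 + u));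
           max (gu ^ a) (gu ^ b)) := by
  have hx1' : 0 < 1 - x := sub_pos.2 hx1
  have hb0 : 0 < b := zero_lt_one.trans hb
  set t := x / (1 - x)
  have ht : 0 < t := div_pos hx0 hx1'
  have hxt : t * (1 - x) = x := div_mul_cancel₀ x hx1'.ne'
  have hxt' : x = t / (1 + t) := by
    rw [eq_div_iff (by positivity)]
    linarith
  have h1x : 1 - x = (1 + t)⁻¹ := by
    rw [hxt']
    field_simp
    ring
  extract_lets u gu
  have hu : 0 < u := lt_min (Real.rpow_pos_of_pos ht _) (Real.rpow_pos_of_pos ht _)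
  have hv0 : 0 < u / (1 + u) := by positivity
  have h1v : 1 - u / (1 + u) = (1 + u)⁻¹ := by
    field_simp
    ring
  have hvx : u ≤ t → u / (1 + u) ≤ x := fun h => by
    rw [hxt', div_le_div_iff₀ (by positivity) (by positivity)]
    linarith
  have hv1 : u / (1 + u) < 1 := by
    rw [div_lt_one (by positivity)]
    linarith
  have hF := hypergeom_zeroBalanced_pos hc hd hcd hv0.le hv1
  have hgu : 0 < gu := mul_pos hv0 hF
  rcases le_total t 1 with h1 | h1
  · have hua : u ^ a = t := by
      have : u = t ^ (1 / a) := min_eq_left <|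
        Real.rpow_le_rpow_of_exponent_ge ht h1 (one_div_le_one_div_of_le ha (ha1.trans hb).le)
      rw [this, ← Real.rpow_mul ht.le, one_div_mul_cancel ha.ne', Real.rpow_one]
    have hut : u ≤ t := by
      refine (min_le_left _ _).trans ?_
      simpa using Real.rpow_le_rpow_of_exponent_ge ht h1 ((one_le_div ha).2 ha1.le)
    set k := (1 - u / (1 + u)) * hypergeom c d (c + d) (u / (1 + u)) with hk
    have hk0 : 0 < k := mul_pos (sub_pos.2 hv1) hF
    have hk1 : k ≤ 1 := one_sub_mul_hypergeom_le_one hc hd hcd hv0.le hv1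
    have hguk : gu = u * k := by
      rw [hk, h1v]
      simp only [gu]
      ring
    calc x * hypergeom c d (c + d) x = t * ((1 - x) * hypergeom c d (c + d) x) := by
          rw [← mul_assoc, hxt]
      _ ≤ t * k := mul_le_mul_of_nonneg_left
          (one_sub_mul_hypergeom_le hc hd hcd hv0.le (hvx hut) hx1) ht.le
      _ ≤ t * k ^ a := mul_le_mul_of_nonneg_left
          (by simpa using Real.rpow_le_rpow_of_exponent_ge hk0 hk1 ha1.le) ht.le
      _ = gu ^ a := by rw [hguk, Real.mul_rpow hu.le hk0.le, hua]
      _ ≤ max (gu ^ a) (gu ^ b) := le_max_left _ _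
      _ ≤ b * max (gu ^ a) (gu ^ b) :=
          le_mul_of_one_le_left (le_max_of_le_left (Real.rpow_pos_of_pos hgu a).le) hb.le
  · have hub : u ^ b = t := by
      have : u = t ^ (1 / b) := min_eq_right <|
        Real.rpow_le_rpow_of_exponent_le h1 (one_div_le_one_div_of_le ha (ha1.trans hb).le)
      rw [this, ← Real.rpow_mul ht.le, one_div_mul_cancel hb0.ne', Real.rpow_one]
    have hut : u ≤ t := by
      refine (min_le_right _ _).trans ?_
      simpa using Real.rpow_le_rpow_of_exponent_le h1 ((div_le_one hb0).2 hb.le)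
    have hlog : Real.log (1 + t) ≤ b * Real.log (1 + u) := by
      rw [← Real.log_rpow (by positivity), ← hub]
      refine Real.log_le_log (by positivity) ?_
      simpa using Real.add_rpow_le_rpow_add zero_le_one hu.le hb.le
    have hlogu : 0 < Real.log (1 + u) := Real.log_pos (by linarith)
    have h := mul_hypergeom_mul_log_le hc hd hcd hv0 (hvx hut) hx1
    rw [h1v, h1x, Real.log_inv, Real.log_inv, neg_neg, neg_neg] at h
    have hle : x * hypergeom c d (c + d) x ≤ b * gu := by
      refine le_of_mul_le_mul_right (h.trans ?_) hlogu
      calc gu * Real.log (1 + t) ≤ gu * (b * Real.log (1 + u)) :=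
            mul_le_mul_of_nonneg_left hlog hgu.le
        _ = b * gu * Real.log (1 + u) := by ring
    exact hle.trans (mul_le_mul_of_nonneg_left (le_max_rpow_rpow ha1.le hb.le hgu) hb0.le)
end

section
/- The function v(x) = log(1 + log(1 + e^x)) is log-concave on ℝ; that is, the function x ↦ log v(x) is concave on ℝ. -/
/-- The derivative of `x ↦ log (log (1 + log (1 + e^x)))`, expressed in terms of
`u = log (1 + e^x)`, is decreasing in `u > 0`. -/
theorem antitoneOn_one_sub_exp_neg_div_mul_log :
    AntitoneOn (fun u : ℝ => (1 - Real.exp (-u)) / ((1 + u) * Real.log (1 + u)))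
      (Set.Ioi 0) := by
  have hderiv : ∀ u ∈ Set.Ioi (0 : ℝ),
      HasDerivAt (fun u : ℝ => (1 - Real.exp (-u)) / ((1 + u) * Real.log (1 + u)))
        ((Real.exp (-u) * ((1 + u) * Real.log (1 + u)) -
          (1 - Real.exp (-u)) * (Real.log (1 + u) + 1)) /
            ((1 + u) * Real.log (1 + u)) ^ 2) u := by
    intro u hu
    have hu : 0 < u := hu
    have hL : 0 < Real.log (1 + u) := Real.log_pos (by linarith)
    have h1 : HasDerivAt (fun u : ℝ => 1 + u) 1 u := (hasDerivAt_id u).const_add 1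
    have h2 : HasDerivAt (fun u : ℝ => 1 - Real.exp (-u)) (Real.exp (-u)) u := by
      simpa using ((hasDerivAt_neg u).exp).const_sub 1
    have h3 : HasDerivAt (fun u : ℝ => (1 + u) * Real.log (1 + u))
        (Real.log (1 + u) + 1) u := by
      have hu1 : 1 + u ≠ 0 := by linarith
      refine (h1.mul (h1.log hu1)).congr_deriv ?_
      rw [one_mul, mul_one_div_cancel hu1]
    exact h2.div h3 (by positivity)
  refine antitoneOn_of_deriv_nonpos (convex_Ioi 0)
    (fun u hu => (hderiv u hu).continuousAt.continuousWithinAt) ?_ ?_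
  · rw [interior_Ioi]
    exact fun u hu => (hderiv u hu).differentiableAt.differentiableWithinAt
  · rw [interior_Ioi]
    intro u hu
    rw [(hderiv u hu).deriv]
    have hu : 0 < u := hu
    refine div_nonpos_of_nonpos_of_nonneg ?_ (sq_nonneg _)
    have hL : 0 < Real.log (1 + u) := Real.log_pos (by linarith)
    have hLu : Real.log (1 + u) ≤ u := by
      linarith [Real.log_le_sub_one_of_pos (show 0 < 1 + u by linarith)]
    have hexp : u * Real.exp (-u) ≤ 1 - Real.exp (-u) := by
      have h := mul_le_mul_of_nonneg_right (Real.add_one_le_exp u) (Real.exp_pos (-u)).le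
      rw [← Real.exp_add, add_neg_cancel, Real.exp_zero] at h
      linarith
    nlinarith [mul_le_mul_of_nonneg_right hexp (by linarith : 0 ≤ Real.log (1 + u) + 1),
      mul_le_mul_of_nonneg_left hLu (Real.exp_pos (-u)).le]

theorem log_one_add_exp_pos (x : ℝ) : 0 < Real.log (1 + Real.exp x) :=
  Real.log_pos (by linarith [Real.exp_pos x])

theorem hasDerivAt_log_log_one_add_log_one_add_exp (x : ℝ) :
    HasDerivAt (fun x : ℝ => Real.log (Real.log (1 + Real.log (1 + Real.exp x))))
      ((1 - Real.exp (-Real.log (1 + Real.exp x))) /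
        ((1 + Real.log (1 + Real.exp x)) * Real.log (1 + Real.log (1 + Real.exp x)))) x := by
  have he : 0 < 1 + Real.exp x := by positivity
  have hu := log_one_add_exp_pos x
  have hv : 0 < Real.log (1 + Real.log (1 + Real.exp x)) := Real.log_pos (by linarith)
  have hu1 : 0 < 1 + Real.log (1 + Real.exp x) := by linarith
  convert (((((Real.hasDerivAt_exp x).const_add 1).log he.ne').const_add 1).log
    hu1.ne').log hv.ne' using 1
  rw [Real.exp_neg, Real.exp_log he]
  field_simp
  ring

/-- Lemma 5.1 (2): the function `v(x) = log(1 + log(1 + e^x))` is log-concave on ℝ,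
i.e. `x ↦ log v(x)` is concave on ℝ. -/
theorem v_log_concave :
    ConcaveOn ℝ Set.univ
      (fun x : ℝ => Real.log (Real.log (1 + Real.log (1 + Real.exp x)))) := by
  refine Antitone.concaveOn_univ_of_deriv
    (fun x => (hasDerivAt_log_log_one_add_log_one_add_exp x).differentiableAt) ?_
  intro x y hxy
  rw [(hasDerivAt_log_log_one_add_log_one_add_exp x).deriv,
    (hasDerivAt_log_log_one_add_log_one_add_exp y).deriv]
  exact antitoneOn_one_sub_exp_neg_div_mul_log (log_one_add_exp_pos x) (log_one_add_exp_pos y)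
    (Real.log_le_log (by positivity) (by gcongr))
end
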